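/- arXiv:2304.14806 — 2 statements merged into one kernel-verified Lean document; each statement's English description precedes it below -/
import Mathlib

section
/- Let S be a C-semigroup in ℕ^d with full cone (cone(S) ∩ ℕ^d = ℕ^d) and let ≺ be a term order on ℕ^d. If S is ≺-almost symmetric, then |H(S) \ PF'_≺(S)| = |{g ∈ S : g ≼ F(S)_≺}|, where ≼ is the componentwise partial order on ℕ^d. -/
open Set

/-- Membership in the rational cone spanned by `S` inside `ℚ^d`. -/
def memCone {d : ℕ} (S : Set (Fin d → ℕ)) (x : Fin d → ℚ) : Prop :=
  ∃ (n : ℕ) (c : Fin n → ℚ) (v : Fin n → (Fin d → ℕ)),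
    (∀ i, 0 ≤ c i) ∧ (∀ i, v i ∈ S) ∧ x = ∑ i, c i • (fun j => ((v i j : ℚ)))

/-- `cone(S) ∩ ℕ^d`, viewed as a subset of `ℕ^d`. -/
def coneN {d : ℕ} (S : Set (Fin d → ℕ)) : Set (Fin d → ℕ) :=
  {x | memCone S (fun j => ((x j : ℚ)))}

/-- `H(S) = (cone(S) \ S) ∩ ℕ^d`. -/
def Hset {d : ℕ} (S : Set (Fin d → ℕ)) : Set (Fin d → ℕ) := coneN S \ S

/-- The set of pseudo-Frobenius elements of `S`. -/
def pfSet {d : ℕ} (S : Set (Fin d → ℕ)) : Set (Fin d → ℕ) :=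
  {f | f ∈ Hset S ∧ ∀ s ∈ S, s ≠ 0 → f + s ∈ S}

/-- A term order on `ℕ^d`: a strict total order compatible with addition. -/
def IsTermOrder {d : ℕ} (prec : (Fin d → ℕ) → (Fin d → ℕ) → Prop) : Prop :=
  (∀ a, ¬ prec a a) ∧ (∀ a b c, prec a b → prec b c → prec a c) ∧
    (∀ a b, a ≠ b → prec a b ∨ prec b a) ∧
    (∀ a b c, prec a b → prec (a + c) (b + c))

/-- `F` is the maximum of `H(S)` with respect to the term order `prec`. -/
def IsFrob {d : ℕ} (S : Set (Fin d → ℕ)) (prec : (Fin d → ℕ) → (Fin d → ℕ) → Prop)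
    (F : Fin d → ℕ) : Prop :=
  F ∈ Hset S ∧ ∀ h ∈ Hset S, h ≠ F → prec h F

/-- A `C`-semigroup: a finitely generated submonoid of `ℕ^d` with
`H(S)` nonempty and finite. -/
def CSemigroup {d : ℕ} (S : AddSubmonoid (Fin d → ℕ)) : Prop :=
  S.FG ∧ (Hset (S : Set (Fin d → ℕ))).Nonempty ∧ (Hset (S : Set (Fin d → ℕ))).Finite

/-- `T` is an ideal of `S`: a subset of `cone(S) ∩ ℕ^d` with `S + T ⊆ T`. -/
def IsIdeal {d : ℕ} (S T : Set (Fin d → ℕ)) : Prop :=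
  T ⊆ coneN S ∧ ∀ s ∈ S, ∀ t ∈ T, s + t ∈ T

/-- `Ω_≺ = {z ∈ cone(S) ∩ ℕ^d : F(S)_≺ − z ∉ S}` (the condition `F − z ∉ S`
is expressed as: there is no `w ∈ S` with `z + w = F`). -/
def omegaSet {d : ℕ} (S : Set (Fin d → ℕ)) (F : Fin d → ℕ) : Set (Fin d → ℕ) :=
  {z ∈ coneN S | ¬ ∃ w ∈ S, z + w = F}

/-- `S` is `≺`-almost symmetric (with Frobenius element `F`):
`PF'(S) = PF(S) \ {F}` is nonempty and `F − g ∈ PF'(S)` for every `g ∈ PF'(S)`. -/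
def AlmostSym {d : ℕ} (S : Set (Fin d → ℕ)) (F : Fin d → ℕ) : Prop :=
  (pfSet S \ {F}).Nonempty ∧ ∀ g ∈ pfSet S \ {F}, ∃ w ∈ pfSet S \ {F}, g + w = F

/-- The unique minimal generating set of a submonoid of `ℕ^d`:
the nonzero elements that are not sums of two nonzero elements. -/
def minGens {d : ℕ} (S : Set (Fin d → ℕ)) : Set (Fin d → ℕ) :=
  {s ∈ S | s ≠ 0 ∧ ¬ ∃ x ∈ S, ∃ y ∈ S, x ≠ 0 ∧ y ≠ 0 ∧ x + y = s}

/-- Every gap lies below a pseudo-Frobenius element, up to an element of the semigroup. -/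
theorem exists_add_mem_pfSet {d : ℕ} (S : AddSubmonoid (Fin d → ℕ))
    (hfull : coneN (S : Set (Fin d → ℕ)) = Set.univ)
    (hfin : (Hset (S : Set (Fin d → ℕ))).Finite)
    {h : Fin d → ℕ} (hh : h ∈ Hset (S : Set (Fin d → ℕ))) :
    ∃ s ∈ S, h + s ∈ pfSet (S : Set (Fin d → ℕ)) := by
  have hTfin : {t ∈ Hset (S : Set (Fin d → ℕ)) | ∃ s ∈ S, h + s = t}.Finite :=
    hfin.subset fun _ ht => ht.1
  obtain ⟨f, ⟨hfH, s, hs, rfl⟩, hmax⟩ :=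
    hTfin.exists_maximal ⟨h, hh, 0, S.zero_mem, add_zero h⟩
  refine ⟨s, hs, hfH, fun t ht ht0 => ?_⟩
  by_contra hn
  have hle := hmax (y := h + s + t)
    ⟨⟨hfull ▸ Set.mem_univ _, hn⟩, s + t, S.add_mem hs ht, (add_assoc _ _ _).symm⟩
    le_self_add
  exact ht0 (by simpa using hle)

/-- If `S` is a `≺`-almost symmetric `C`-semigroup with full cone, then
`|H(S) \ PF'_≺(S)| = |{g ∈ S : g ≼ F(S)_≺}|` (componentwise order). -/
theorem almostSym_card_eq {d : ℕ} (S : AddSubmonoid (Fin d → ℕ)) (hC : CSemigroup S)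
    (hfull : coneN (S : Set (Fin d → ℕ)) = Set.univ)
    (prec : (Fin d → ℕ) → (Fin d → ℕ) → Prop) (hprec : IsTermOrder prec)
    (F : Fin d → ℕ) (hF : IsFrob (S : Set (Fin d → ℕ)) prec F)
    (hAS : AlmostSym (S : Set (Fin d → ℕ)) F) :
    (Hset (S : Set (Fin d → ℕ)) \ (pfSet (S : Set (Fin d → ℕ)) \ {F})).ncard =
      {g ∈ (S : Set (Fin d → ℕ)) | g ≤ F}.ncard := by
  symm
  refine Set.ncard_congr (fun g _ => F - g) ?_ ?_ ?_
  · rintro g ⟨hgS, hgF⟩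
    have hsub : F - g + g = F := tsub_add_cancel_of_le hgF
    refine ⟨⟨hfull ▸ Set.mem_univ _, fun hmem => hF.1.2 ?_⟩, fun hpf => ?_⟩
    · rw [← hsub]
      exact S.add_mem hmem hgS
    · obtain ⟨w, hw, hwF⟩ := hAS.2 _ hpf
      obtain rfl : w = g := add_left_cancel (hwF.trans hsub.symm)
      exact hw.1.1.2 hgS
  · rintro a b ⟨_, ha⟩ ⟨_, hb⟩ hab
    exact (tsub_right_inj ha hb).1 hab
  · rintro h ⟨hH, hpf⟩
    suffices hkey : ∃ g ∈ S, h + g = F by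
      obtain ⟨g, hg, rfl⟩ := hkey
      exact ⟨g, ⟨hg, le_add_self⟩, add_tsub_cancel_right h g⟩
    obtain ⟨s, hs, hsp⟩ := exists_add_mem_pfSet S hfull hC.2.2 hH
    by_cases hsF : h + s = F
    · exact ⟨s, hs, hsF⟩
    obtain ⟨w, hw, hwF⟩ := hAS.2 (h + s) ⟨hsp, hsF⟩
    have hs0 : s ≠ 0 := by
      rintro rfl
      rw [add_zero] at hsp hsF
      exact hpf ⟨hsp, hsF⟩
    exact ⟨w + s, hw.1.2 s hs hs0, by rw [← hwF, add_assoc, add_comm w]⟩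
end

section
/- Let a ≥ 3 be an odd natural number, p ≥ 1 an integer, and let S_{a,p} be the submonoid of ℕ² generated by (a,0), (0,a^p), (a+2,2), (2,2+a^p). Let Δ = {(a^p(a+2) − (ℓ+2)a − 2, a^p(ℓ+2) − 2) : 0 ≤ ℓ < a^p − 1}. Then Δ ⊆ PF(S_{a,p}); in particular PF(S_{a,p}) is nonempty and |PF(S_{a,p})| ≥ a^p − 1. -/
open Set

/-- The affine semigroup `S_{a,p} = ⟨(a,0), (0,a^p), (a+2,2), (2,2+a^p)⟩ ⊆ ℕ²`. -/
def Sap (a p : ℕ) : AddSubmonoid (Fin 2 → ℕ) :=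
  AddSubmonoid.closure {![a, 0], ![0, a ^ p], ![a + 2, 2], ![2, 2 + a ^ p]}

/-- The set `Δ = {(a^p(a+2) − (ℓ+2)a − 2, a^p(ℓ+2) − 2) : 0 ≤ ℓ < a^p − 1}`. -/
def deltaSet (a p : ℕ) : Set (Fin 2 → ℕ) :=
  {v | ∃ ℓ : ℕ, ℓ < a ^ p - 1 ∧
    v = ![a ^ p * (a + 2) - (ℓ + 2) * a - 2, a ^ p * (ℓ + 2) - 2]}

/-- Explicit form of the elements of `Sap a p`: the pairs `(aA + 2n, a^p B + 2n)` with
`n ≤ A + B`. -/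
theorem mem_Sap_iff {a p : ℕ} {v : Fin 2 → ℕ} :
    v ∈ Sap a p ↔ ∃ A B n : ℕ, n ≤ A + B ∧ v = ![a * A + 2 * n, a ^ p * B + 2 * n] := by
  constructor
  · intro hv
    induction hv using AddSubmonoid.closure_induction with
    | mem x hx =>
      rcases hx with rfl | rfl | rfl | rfl
      · exact ⟨1, 0, 0, by simp, by simp⟩
      · exact ⟨0, 1, 0, by simp, by simp⟩
      · exact ⟨1, 0, 1, by simp, by simp⟩
      · exact ⟨0, 1, 1, by simp, by simp [add_comm]⟩
    | zero => exact ⟨0, 0, 0, by simp, by ext i; fin_cases i <;> simp⟩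
    | add x y _ _ hx hy =>
      obtain ⟨A, B, n, h, rfl⟩ := hx
      obtain ⟨A', B', n', h', rfl⟩ := hy
      refine ⟨A + A', B + B', n + n', by omega, ?_⟩
      ext i
      fin_cases i <;> simp <;> ring
  · rintro ⟨A, B, n, h, rfl⟩
    obtain ⟨c, d, hc, hd, rfl⟩ : ∃ c d, c ≤ A ∧ d ≤ B ∧ n = c + d :=
      ⟨min A n, n - min A n, by omega, by omega, by omega⟩
    obtain ⟨A, rfl⟩ := Nat.exists_eq_add_of_le hc
    obtain ⟨B, rfl⟩ := Nat.exists_eq_add_of_le hd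
    have hgen : ∀ x ∈ ({![a, 0], ![0, a ^ p], ![a + 2, 2], ![2, 2 + a ^ p]} :
        Set (Fin 2 → ℕ)), ∀ k : ℕ, k • x ∈ Sap a p :=
      fun x hx k => nsmul_mem (AddSubmonoid.subset_closure hx) k
    have hsum := add_mem (add_mem (hgen ![a, 0] (by simp) A) (hgen ![0, a ^ p] (by simp) B))
      (add_mem (hgen ![a + 2, 2] (by simp) c) (hgen ![2, 2 + a ^ p] (by simp) d))
    convert hsum using 1
    ext i
    fin_cases i <;> simp <;> ring

theorem mem_coneN_Sap {a p : ℕ} (ha : a ≠ 0) (v : Fin 2 → ℕ) :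
    v ∈ coneN (Sap a p : Set (Fin 2 → ℕ)) := by
  have ha' : (a : ℚ) ≠ 0 := by exact_mod_cast ha
  refine ⟨2, ![(v 0 : ℚ) / a, (v 1 : ℚ) / (a : ℚ) ^ p], ![![a, 0], ![0, a ^ p]], ?_, ?_, ?_⟩
  · intro i
    fin_cases i <;> simp <;> positivity
  · intro i
    apply AddSubmonoid.subset_closure
    fin_cases i <;> simp
  · ext i
    fin_cases i <;> simp [Fin.sum_univ_two, ha']

/-- The elements of `deltaSet a p`, without subtraction in the coordinates. -/
theorem deltaSet_elem_eq {a q ℓ : ℕ} (hℓ : ℓ < q - 1) :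
    (![q * (a + 2) - (ℓ + 2) * a - 2, q * (ℓ + 2) - 2] : Fin 2 → ℕ) =
      ![a * (q - 2 - ℓ) + 2 * (q - 1), q * ℓ + 2 * (q - 1)] := by
  obtain ⟨m, rfl⟩ : ∃ m, q = ℓ + 2 + m := ⟨q - 2 - ℓ, by omega⟩
  have h₁ : (ℓ + 2 + m) * (a + 2) = a * m + 2 * (ℓ + 1 + m) + 2 + (ℓ + 2) * a := by ring
  have h₂ : (ℓ + 2 + m) * (ℓ + 2) = (ℓ + 2 + m) * ℓ + 2 * (ℓ + 1 + m) + 2 := by ring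
  have h₃ : ℓ + 2 + m - 2 - ℓ = m := by omega
  have h₄ : ℓ + 2 + m - 1 = ℓ + 1 + m := by omega
  rw [h₁, h₂, h₃, h₄, Nat.add_sub_cancel, Nat.add_sub_cancel, Nat.add_sub_cancel]

theorem notMem_Sap {a p A B : ℕ} (ha : a ≠ 0) (hodd : Odd a) (hAB : A + B + 1 < a ^ p) :
    ![a * A + 2 * (a ^ p - 1), a ^ p * B + 2 * (a ^ p - 1)] ∉ Sap a p := by
  rw [mem_Sap_iff]
  rintro ⟨A', B', n, hn, h⟩
  have h₀ : a * A + 2 * (a ^ p - 1) = a * A' + 2 * n := by simpa using congrFun h 0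
  have h₁ : a ^ p * B + 2 * (a ^ p - 1) = a ^ p * B' + 2 * n := by simpa using congrFun h 1
  have hcop : Nat.Coprime (a ^ p) 2 := (Nat.coprime_two_right).2 hodd.pow
  have hdvd : a ^ p ∣ n + 1 := by
    refine hcop.dvd_of_dvd_mul_left ((Nat.dvd_add_right (Dvd.intro B' rfl)).1 ⟨B + 2, ?_⟩)
    rw [mul_add (a ^ p)]
    omega
  have hle : a ^ p ≤ n + 1 := Nat.le_of_dvd n.succ_pos hdvd
  have hA : A' ≤ A := Nat.le_of_mul_le_mul_left (by omega : a * A' ≤ a * A) (by omega)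
  have hB : B' ≤ B :=
    Nat.le_of_mul_le_mul_left (by omega : a ^ p * B' ≤ a ^ p * B) (by omega)
  omega

theorem add_mem_Sap {a p A B : ℕ} (hp : 1 ≤ p) (hAB : a ^ p = A + B + 2) {s : Fin 2 → ℕ}
    (hs : s ∈ Sap a p) (hs₀ : s ≠ 0) :
    ![a * A + 2 * (a ^ p - 1), a ^ p * B + 2 * (a ^ p - 1)] + s ∈ Sap a p := by
  obtain ⟨A', B', n, hn, rfl⟩ := mem_Sap_iff.1 hs
  obtain ⟨r, hr⟩ : a ∣ a ^ p := dvd_pow_self a (by omega)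
  rw [mem_Sap_iff]
  rcases n with _ | n
  · have hpos : 1 ≤ A' + B' := by
      by_contra hlt
      obtain ⟨rfl, rfl⟩ : A' = 0 ∧ B' = 0 := by omega
      simp at hs₀
    refine ⟨A + A', B + B', a ^ p - 1, by omega, ?_⟩
    ext i
    fin_cases i <;> simp <;> ring
  · refine ⟨A + A' + 2 * r, B + B' + 2, n, by omega, ?_⟩
    have hx : a * (A + A' + 2 * r) = a * A + a * A' + 2 * a ^ p := by rw [hr]; ring
    have hy : a ^ p * (B + B' + 2) = a ^ p * B + a ^ p * B' + 2 * a ^ p := by ring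
    rw [hx, hy]
    ext i
    fin_cases i <;> simp <;> omega

theorem deltaSet_subset {a p : ℕ} (ha : a ≠ 0) (hodd : Odd a) (hp : 1 ≤ p) :
    deltaSet a p ⊆ pfSet (Sap a p : Set (Fin 2 → ℕ)) := by
  rintro _ ⟨ℓ, hℓ, rfl⟩
  rw [deltaSet_elem_eq hℓ]
  exact ⟨⟨mem_coneN_Sap ha _, notMem_Sap ha hodd (by omega)⟩,
    fun s hs hs₀ => add_mem_Sap hp (by omega) hs hs₀⟩

theorem encard_deltaSet (a p : ℕ) : (deltaSet a p).encard = (a ^ p - 1 : ℕ) := by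
  have himage : deltaSet a p = (fun ℓ : ℕ =>
      (![a ^ p * (a + 2) - (ℓ + 2) * a - 2, a ^ p * (ℓ + 2) - 2] : Fin 2 → ℕ)) ''
        (Finset.range (a ^ p - 1) : Set ℕ) := by
    ext v
    simp [deltaSet, eq_comm]
  rw [himage, InjOn.encard_image, Set.encard_coe_eq_coe_finsetCard, Finset.card_range]
  intro ℓ hℓ m hm h
  simp only [Finset.coe_range, mem_Iio] at hℓ hm
  simp only [deltaSet_elem_eq hℓ, deltaSet_elem_eq hm] at h
  have h₁ : a ^ p * ℓ = a ^ p * m := by simpa using congrFun h 1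
  exact Nat.eq_of_mul_eq_mul_left (by omega) h₁

/-- For odd `a ≥ 3` and `p ≥ 1`, `Δ ⊆ PF(S_{a,p})`; in particular
`PF(S_{a,p})` is nonempty and `|PF(S_{a,p})| ≥ a^p − 1`. -/
theorem deltaSet_subset_pfSet (a p : ℕ) (ha : 3 ≤ a) (hodd : Odd a) (hp : 1 ≤ p) :
    deltaSet a p ⊆ pfSet ((Sap a p : AddSubmonoid (Fin 2 → ℕ)) : Set (Fin 2 → ℕ)) ∧
    (pfSet ((Sap a p : AddSubmonoid (Fin 2 → ℕ)) : Set (Fin 2 → ℕ))).Nonempty ∧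
    ((a ^ p - 1 : ℕ) : ℕ∞) ≤
      (pfSet ((Sap a p : AddSubmonoid (Fin 2 → ℕ)) : Set (Fin 2 → ℕ))).encard := by
  have hsub := deltaSet_subset (by omega : a ≠ 0) hodd hp
  have hq : a ≤ a ^ p := Nat.le_self_pow (by omega) a
  exact ⟨hsub, ⟨_, hsub ⟨0, by omega, rfl⟩⟩, encard_deltaSet a p ▸ encard_le_encard hsub⟩
end
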